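/- Let d ≥ 2, n ≥ 2 and 1 ≤ h ≤ n/2, and let μ = (n−h, h, 0, …, 0). Then for the prior p = 1/2, the permutation test Π = Π_{(n)} maximizes the average success probability (1/2)·Tr[Π ρ_=^n] + (1/2)·(1 − Tr[Π ρ_≠^μ]) over all Hermitian Π with 0 ⪯ Π ⪯ I, the optimal value equals 1 − 1/(2·binom(n,h)), and the permutation test has perfect completeness Tr[Π_{(n)} ρ_=^n] = 1 and soundness 1 − Tr[Π_{(n)} ρ_≠^μ] = 1 − 1/binom(n,h). -/

import Mathlib

open MeasureTheory Matrix
open scoped ComplexOrder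

noncomputable section

/-- The unitary group `U(d)`. -/
abbrev UG (d : ℕ) := Matrix.unitaryGroup (Fin d) ℂ

noncomputable instance (d : ℕ) : MeasurableSpace (UG d) := borel _

instance (d : ℕ) : BorelSpace (UG d) := ⟨rfl⟩

/-- The permutation matrix `ψ(π)` on `(ℂ^d)^{⊗n}`, with `(x,y)` entry `1` iff `y = x ∘ π`. -/
def psi (d n : ℕ) (π : Equiv.Perm (Fin n)) : Matrix (Fin n → Fin d) (Fin n → Fin d) ℂ :=
  Matrix.of fun x y => if y = x ∘ π then 1 else 0

/-- The symmetrizer `Π_{(n)} = (1/n!) ∑_{π ∈ S_n} ψ(π)`. -/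
def symmetrizer (d n : ℕ) : Matrix (Fin n → Fin d) (Fin n → Fin d) ℂ :=
  ((n.factorial : ℂ))⁻¹ • ∑ π : Equiv.Perm (Fin n), psi d n π

/-- The `n`-fold tensor power of a `d × d` matrix: `(U^{⊗n})_{x,y} = ∏ i, U_{x i, y i}`. -/
def tpow (d n : ℕ) (U : Matrix (Fin d) (Fin d) ℂ) :
    Matrix (Fin n → Fin d) (Fin n → Fin d) ℂ :=
  Matrix.of fun x y => ∏ i, U (x i) (y i)

/-- The list consisting of `μ 0` copies of `0`, then `μ 1` copies of `1`, etc. -/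
def wordList (d : ℕ) (μ : Fin d → ℕ) : List (Fin d) :=
  (List.ofFn fun i => List.replicate (μ i) i).flatten

lemma wordList_length (d : ℕ) (μ : Fin d → ℕ) : (wordList d μ).length = ∑ i, μ i := by
  simp [wordList, List.length_flatten, Function.comp, List.sum_ofFn]

/-- The word indexing the basis vector `|e_μ⟩`: the first `μ 0` tensor factors carry the
first basis label, the next `μ 1` factors the second basis label, etc. -/
def word (d n : ℕ) (μ : Fin d → ℕ) (hsum : ∑ i, μ i = n) (j : Fin n) : Fin d :=
  (wordList d μ).get ⟨j, by rw [wordList_length, hsum]; exact j.isLt⟩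

/-- `∫ U^{⊗n} |e_w⟩⟨e_w| (U^{⊗n})^† dq` for a basis word `w` (entrywise Bochner integral). -/
def rhoWord (d n : ℕ) (w : Fin n → Fin d) (q : Measure (UG d)) :
    Matrix (Fin n → Fin d) (Fin n → Fin d) ℂ :=
  Matrix.of fun x y =>
    ∫ U : UG d, tpow d n (U : Matrix (Fin d) (Fin d) ℂ) x w *
      star (tpow d n (U : Matrix (Fin d) (Fin d) ℂ) y w) ∂q

/-- The Haar-twirled unequal state `ρ_≠^μ`. -/
def rhoNE (d n : ℕ) (μ : Fin d → ℕ) (hsum : ∑ i, μ i = n) (haar : Measure (UG d)) :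
    Matrix (Fin n → Fin d) (Fin n → Fin d) ℂ :=
  rhoWord d n (word d n μ hsum) haar

/-- The partition `(n, 0, …, 0)`. -/
def muEq (d n : ℕ) (hd : 0 < d) : Fin d → ℕ := fun i => if i = ⟨0, hd⟩ then n else 0

lemma muEq_sum (d n : ℕ) (hd : 0 < d) : ∑ i, muEq d n hd i = n := by
  simp [muEq]

/-- The equal state `ρ_=^n = ρ_≠^{(n,0,…,0)}`. -/
def rhoEQ (d n : ℕ) (hd : 0 < d) (haar : Measure (UG d)) :
    Matrix (Fin n → Fin d) (Fin n → Fin d) ℂ :=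
  rhoNE d n (muEq d n hd) (muEq_sum d n hd) haar

/-- The set of POVM elements: Hermitian `P` with `0 ⪯ P ⪯ I`. -/
def POVMs (d n : ℕ) : Set (Matrix (Fin n → Fin d) (Fin n → Fin d) ℂ) :=
  {P | P.PosSemidef ∧ (1 - P).PosSemidef}

/-- The average success probability of the test `{P, I - P}` with prior `p` on the equal case. -/
def successProb (d n : ℕ) (hd : 0 < d) (μ : Fin d → ℕ) (hsum : ∑ i, μ i = n)
    (haar : Measure (UG d)) (p : ℝ) (P : Matrix (Fin n → Fin d) (Fin n → Fin d) ℂ) : ℝ :=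
  p * (Matrix.trace (P * rhoEQ d n hd haar)).re +
    (1 - p) * (1 - (Matrix.trace (P * rhoNE d n μ hsum haar)).re)

/-- The partition `(n - h, h, 0, …, 0)`. -/
def muTwo (d n h : ℕ) (hd : 2 ≤ d) : Fin d → ℕ := fun i =>
  if i = ⟨0, by omega⟩ then n - h else if i = ⟨1, by omega⟩ then h else 0

lemma muTwo_sum (d n h : ℕ) (hd : 2 ≤ d) (hh : h ≤ n) : ∑ i, muTwo d n h hd i = n := by
  have key : ∀ i : Fin d, muTwo d n h hd i
      = (if i = ⟨0, by omega⟩ then n - h else 0) + (if i = ⟨1, by omega⟩ then h else 0) := by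
    intro i
    by_cases h0 : i = ⟨0, by omega⟩ <;> by_cases h1 : i = ⟨1, by omega⟩ <;>
      simp_all [muTwo, Fin.ext_iff]
  rw [Finset.sum_congr rfl fun i _ => key i, Finset.sum_add_distrib]
  simp [Finset.sum_ite_eq']
  omega


lemma sum_prod_fn {n : ℕ} {κ : Type*} [Fintype κ] [DecidableEq κ] (g : Fin n → κ → ℂ) :
    ∑ e : Fin n → κ, ∏ i, g i (e i) = ∏ i, ∑ b, g i b := by
  rw [Finset.prod_univ_sum, Fintype.piFinset_univ]

def sgb (b : Bool) : ℂ := if b then 1 else -1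

lemma sgb_sq (b : Bool) : sgb b * sgb b = 1 := by cases b <;> simp [sgb]

lemma sgb_aux {n : ℕ} (f : Fin n → Fin n) (hf : ¬ Function.Bijective f) :
    ∑ e : Fin n → Bool, (∏ i, sgb (e i)) * ∏ j, sgb (e (f j)) = 0 := by
  have hs : ¬ Function.Surjective f := fun h => hf (Finite.surjective_iff_bijective.1 h)
  simp only [Function.Surjective, not_forall, not_exists] at hs
  obtain ⟨i0, hi0⟩ := hs
  have key : ∀ e : Fin n → Bool, (∏ i, sgb (e i)) * ∏ j, sgb (e (f j))
      = ∏ i, (sgb (e i) * sgb (e i) ^ (Finset.univ.filter fun j => f j = i).card) := by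
    intro e
    rw [Finset.prod_mul_distrib]
    congr 1
    rw [← Finset.prod_fiberwise Finset.univ f]
    refine Finset.prod_congr rfl fun i _ => ?_
    rw [Finset.prod_congr rfl (g := fun _ => sgb (e i)), Finset.prod_const]
    intro j hj
    simp at hj
    rw [hj]
  simp only [key]
  rw [sum_prod_fn (fun i b => sgb b * sgb b ^ (Finset.univ.filter fun j => f j = i).card)]
  apply Finset.prod_eq_zero (Finset.mem_univ i0)
  have : (Finset.univ.filter fun j => f j = i0) = ∅ := by
    ext j; simp [hi0 j]
  rw [this]
  simp [sgb]

lemma sgb_aux2 {n : ℕ} (f : Equiv.Perm (Fin n)) :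
    ∑ e : Fin n → Bool, (∏ i, sgb (e i)) * ∏ j, sgb (e (f j)) = 2 ^ n := by
  have key : ∀ e : Fin n → Bool, (∏ i, sgb (e i)) * ∏ j, sgb (e (f j)) = 1 := by
    intro e
    rw [Equiv.prod_comp f (fun i => sgb (e i)), ← Finset.prod_mul_distrib]
    exact Finset.prod_eq_one fun i _ => sgb_sq _
  simp [key]

lemma polarization {n : ℕ} (a : Fin n → Fin n → ℂ) :
    ∑ e : Fin n → Bool, (∏ i, sgb (e i)) * ∏ j, ∑ i, sgb (e i) * a i j
      = 2 ^ n * ∑ p : Equiv.Perm (Fin n), ∏ j, a (p j) j := by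
  have h1 : ∀ e : Fin n → Bool, (∏ i, sgb (e i)) * ∏ j, ∑ i, sgb (e i) * a i j
      = ∑ f : Fin n → Fin n, ((∏ i, sgb (e i)) * ∏ j, sgb (e (f j))) * ∏ j, a (f j) j := by
    intro e
    rw [← sum_prod_fn (fun j i => sgb (e i) * a i j), Finset.mul_sum]
    refine Finset.sum_congr rfl fun f _ => ?_
    rw [Finset.prod_mul_distrib, mul_assoc]
  simp only [h1]
  rw [Finset.sum_comm]
  simp only [← Finset.sum_mul]
  rw [Finset.mul_sum]
  symm
  apply Finset.sum_of_injOn (fun p : Equiv.Perm (Fin n) => (p : Fin n → Fin n))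
  · intro p _ q _ h
    exact Equiv.coe_fn_injective h
  · intro p _; simp
  · intro f _ hf
    rw [sgb_aux, zero_mul]
    intro hb
    apply hf
    exact ⟨Equiv.ofBijective f hb, by simp, by ext; simp⟩
  · intro p _
    rw [sgb_aux2]

/-- the vector `u^{⊗n}`. -/
def tvec (d n : ℕ) (u : Fin d → ℂ) : (Fin n → Fin d) → ℂ := fun x => ∏ i, u (x i)

lemma symm_apply (d n : ℕ) (x y : Fin n → Fin d) :
    symmetrizer d n x y = (n.factorial : ℂ)⁻¹ *
      ∑ p : Equiv.Perm (Fin n), if y = x ∘ p then 1 else 0 := by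
  simp [symmetrizer, psi, Matrix.sum_apply]

lemma symm_col (d n : ℕ) (w x : Fin n → Fin d) :
    symmetrizer d n x w = (n.factorial : ℂ)⁻¹ * (2 ^ n)⁻¹ *
      ∑ e : Fin n → Bool, (∏ i, sgb (e i)) *
        tvec d n (fun k => ∑ i, sgb (e i) * if w i = k then 1 else 0) x := by
  have := polarization (fun i j => if w i = x j then (1:ℂ) else 0)
  simp only [tvec]
  rw [this, symm_apply, mul_assoc, inv_mul_cancel_left₀ (by positivity)]
  congr 1
  rw [← Equiv.sum_comp (Equiv.inv (Equiv.Perm (Fin n)))]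
  refine Finset.sum_congr rfl fun p _ => ?_
  rw [Finset.prod_ite_zero]
  simp only [Finset.prod_const_one, Finset.mem_univ, true_imp_iff]
  congr 1
  apply propext
  simp only [Equiv.inv_apply, funext_iff, Function.comp]
  constructor
  · intro h i; rw [h]; simp
  · intro h i; rw [← h]; simp

lemma tpow_mul (d n : ℕ) (A B : Matrix (Fin d) (Fin d) ℂ) :
    tpow d n (A * B) = tpow d n A * tpow d n B := by
  ext x y
  simp only [tpow, Matrix.of_apply, Matrix.mul_apply]
  rw [← sum_prod_fn (fun i k => A (x i) k * B k (y i))]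
  simp [Finset.prod_mul_distrib]

lemma tpow_one (d n : ℕ) : tpow d n 1 = 1 := by
  ext x y
  simp only [tpow, Matrix.of_apply, Matrix.one_apply]
  rw [Finset.prod_ite_zero]
  simp [funext_iff]

lemma tpow_conjTranspose (d n : ℕ) (A : Matrix (Fin d) (Fin d) ℂ) :
    (tpow d n A)ᴴ = tpow d n Aᴴ := by
  ext x y
  simp [tpow, Matrix.conjTranspose_apply]

lemma tpow_unit (d n : ℕ) (V : UG d) :
    (tpow d n (V : Matrix (Fin d) (Fin d) ℂ))ᴴ * tpow d n (V : Matrix (Fin d) (Fin d) ℂ) = 1 := by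
  rw [tpow_conjTranspose, ← tpow_mul, ← Matrix.star_eq_conjTranspose,
    Matrix.mem_unitaryGroup_iff'.1 V.2, tpow_one]

lemma psi_mul_apply (d n : ℕ) (p : Equiv.Perm (Fin n)) (f : (Fin n → Fin d) → ℂ)
    (x : Fin n → Fin d) : ∑ y, psi d n p x y * f y = f (x ∘ p) := by
  simp [psi]

lemma symm_mul_apply (d n : ℕ) (f : (Fin n → Fin d) → ℂ)
    (x : Fin n → Fin d) : ∑ y, symmetrizer d n x y * f y =
      (n.factorial : ℂ)⁻¹ * ∑ p : Equiv.Perm (Fin n), f (x ∘ p) := by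
  simp only [← psi_mul_apply]
  rw [Finset.sum_comm, Finset.mul_sum]
  refine Finset.sum_congr rfl fun y _ => ?_
  rw [← Finset.sum_mul, ← mul_assoc]
  congr 1
  simp [symmetrizer, Matrix.sum_apply]

lemma symm_fix (d n : ℕ) (f : (Fin n → Fin d) → ℂ)
    (hf : ∀ (p : Equiv.Perm (Fin n)) x, f (x ∘ p) = f x)
    (x : Fin n → Fin d) : ∑ y, symmetrizer d n x y * f y = f x := by
  rw [symm_mul_apply]
  simp only [hf]
  have : (n.factorial : ℂ) ≠ 0 := by exact_mod_cast n.factorial_ne_zero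
  simp [Fintype.card_perm, this]

lemma tvec_perm (d n : ℕ) (u : Fin d → ℂ) (p : Equiv.Perm (Fin n)) (x : Fin n → Fin d) :
    tvec d n u (x ∘ p) = tvec d n u x :=
  Equiv.prod_comp p (fun i => u (x i))

lemma symm_perm (d n : ℕ) (w : Fin n → Fin d) (p : Equiv.Perm (Fin n)) (x : Fin n → Fin d) :
    symmetrizer d n (x ∘ p) w = symmetrizer d n x w := by
  rw [symm_col, symm_col]
  simp only [tvec_perm]

lemma symm_sq (d n : ℕ) : symmetrizer d n * symmetrizer d n = symmetrizer d n := by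
  ext x y
  rw [Matrix.mul_apply]
  exact symm_fix d n (fun z => symmetrizer d n z y) (fun p x => symm_perm d n y p x) x

lemma symm_symm (d n : ℕ) (x y : Fin n → Fin d) : symmetrizer d n x y = symmetrizer d n y x := by
  rw [symm_apply, symm_apply]
  congr 1
  rw [← Equiv.sum_comp (Equiv.inv (Equiv.Perm (Fin n)))]
  refine Finset.sum_congr rfl fun p _ => ?_
  congr 1
  apply propext
  simp only [Equiv.inv_apply, funext_iff, Function.comp]
  constructor
  · intro h i; rw [h]; simp
  · intro h i; rw [h]; simp

lemma symm_herm (d n : ℕ) : (symmetrizer d n)ᴴ = symmetrizer d n := by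
  ext x y
  rw [Matrix.conjTranspose_apply, symm_symm, symm_apply]
  simp

lemma symm_comm (d n : ℕ) (A : Matrix (Fin d) (Fin d) ℂ) :
    symmetrizer d n * tpow d n A = tpow d n A * symmetrizer d n := by
  ext x y
  rw [Matrix.mul_apply, Matrix.mul_apply, symm_mul_apply d n (fun z => tpow d n A z y)]
  have : ∀ z, tpow d n A x z * symmetrizer d n z y = symmetrizer d n y z * tpow d n A x z := by
    intro z; rw [symm_symm, mul_comm]
  simp only [this]
  rw [symm_mul_apply d n (fun z => tpow d n A x z)]
  congr 1
  rw [← Equiv.sum_comp (Equiv.inv (Equiv.Perm (Fin n)))]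
  refine Finset.sum_congr rfl fun p _ => ?_
  simp only [tpow, Matrix.of_apply, Function.comp, Equiv.inv_apply]
  rw [← Equiv.prod_comp p]
  simp

lemma symm_diag (d n : ℕ) (w : Fin n → Fin d) :
    symmetrizer d n w w = (n.factorial : ℂ)⁻¹ *
      ((∏ i, (Fintype.card {a // w a = i}).factorial : ℕ) : ℂ) := by
  rw [symm_apply, ← DomMulAct.stabilizer_card w, Fintype.card_subtype]
  congr 1
  rw [Finset.sum_boole]
  simp only [eq_comm]

lemma word_card (d n : ℕ) (μ : Fin d → ℕ) (hsum : ∑ i, μ i = n) (i : Fin d) :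
    Fintype.card {a // word d n μ hsum a = i} = μ i := by
  have hl : (wordList d μ).length = n := by rw [wordList_length, hsum]
  have := Fin.card_filter_univ_eq_vector_get_eq_count i
    (⟨wordList d μ, hl⟩ : List.Vector (Fin d) n)
  rw [Fintype.card_subtype]
  have h2 : List.count i (wordList d μ) = μ i := by
    rw [wordList, List.count_flatten, List.map_ofFn, List.sum_ofFn]
    simp [List.count_replicate]
  rw [← h2]
  refine Eq.trans ?_ this
  congr 1

lemma word_const (d n : ℕ) (hd : 0 < d) :
    word d n (muEq d n hd) (muEq_sum d n hd) = fun _ => ⟨0, hd⟩ := by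
  funext j
  by_contra hne
  have := word_card d n (muEq d n hd) (muEq_sum d n hd) (word d n (muEq d n hd) (muEq_sum d n hd) j)
  rw [muEq, if_neg hne, Fintype.card_eq_zero_iff] at this
  exact this.false ⟨j, rfl⟩

/-- `U^{⊗n} e_w`. -/
def vw (d n : ℕ) (w : Fin n → Fin d) (U : UG d) (x : Fin n → Fin d) : ℂ :=
  tpow d n (U : Matrix (Fin d) (Fin d) ℂ) x w

lemma vw_cont (d n : ℕ) (w x : Fin n → Fin d) : Continuous fun U : UG d => vw d n w U x := by
  simp only [vw, tpow, Matrix.of_apply]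
  refine continuous_finsetProd _ fun i _ => ?_
  exact (continuous_subtype_val (p := fun U : Matrix (Fin d) (Fin d) ℂ =>
    U ∈ Matrix.unitaryGroup (Fin d) ℂ)).matrix_elem (x i) (w i)

lemma vw_norm (d n : ℕ) (w x : Fin n → Fin d) (U : UG d) : ‖vw d n w U x‖ ≤ 1 := by
  simp only [vw, tpow, Matrix.of_apply, norm_prod]
  exact Finset.prod_le_one (fun _ _ => norm_nonneg _)
    fun i _ => entry_norm_bound_of_unitary U.2 _ _

lemma vw_int (d n : ℕ) (w x y : Fin n → Fin d) (q : Measure (UG d)) [IsProbabilityMeasure q] :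
    Integrable (fun U : UG d => vw d n w U x * star (vw d n w U y)) q := by
  refine Integrable.of_bound (C := 1) ?_ (Filter.Eventually.of_forall fun U => ?_)
  · exact ((vw_cont d n w x).mul (vw_cont d n w y).star).measurable.aestronglyMeasurable
  · rw [norm_mul, norm_star]
    exact mul_le_one₀ (vw_norm ..) (norm_nonneg _) (vw_norm ..)

lemma rho_apply (d n : ℕ) (w x y : Fin n → Fin d) (q : Measure (UG d)) :
    rhoWord d n w q x y = ∫ U : UG d, vw d n w U x * star (vw d n w U y) ∂q := rfl

lemma rho_sum (d n : ℕ) (w : Fin n → Fin d) (q : Measure (UG d)) [IsProbabilityMeasure q]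
    (M : (Fin n → Fin d) → (Fin n → Fin d) → ℂ) :
    ∑ x, ∑ y, M x y * rhoWord d n w q x y =
      ∫ U : UG d, ∑ x, ∑ y, M x y * (vw d n w U x * star (vw d n w U y)) ∂q := by
  rw [integral_finsetSum _ fun x _ => integrable_finsetSum _ fun y _ =>
    (vw_int d n w x y q).const_mul _]
  refine Finset.sum_congr rfl fun x _ => ?_
  rw [integral_finsetSum _ fun y _ => (vw_int d n w x y q).const_mul _]
  refine Finset.sum_congr rfl fun y _ => ?_
  rw [integral_const_mul, rho_apply]

lemma rho_herm (d n : ℕ) (w : Fin n → Fin d) (q : Measure (UG d)) :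
    (rhoWord d n w q)ᴴ = rhoWord d n w q := by
  ext x y
  rw [Matrix.conjTranspose_apply, rho_apply, rho_apply, Complex.star_def, ← integral_conj]
  congr 1
  ext U
  simp [mul_comm]

lemma rho_psd (d n : ℕ) (w : Fin n → Fin d) (q : Measure (UG d)) [IsProbabilityMeasure q] :
    (rhoWord d n w q).PosSemidef := by
  refine .of_dotProduct_mulVec_nonneg (rho_herm d n w q) fun v => ?_
  have h1 : star v ⬝ᵥ (rhoWord d n w q) *ᵥ v
      = ∑ x, ∑ y, (star (v x) * v y) * rhoWord d n w q x y := by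
    simp only [dotProduct, mulVec, Finset.mul_sum, Pi.star_apply]
    refine Finset.sum_congr rfl fun x _ => Finset.sum_congr rfl fun y _ => by ring
  rw [h1, rho_sum]
  have h2 : ∀ U : UG d, ∑ x, ∑ y, (star (v x) * v y) * (vw d n w U x * star (vw d n w U y))
      = ((‖∑ x, star (v x) * vw d n w U x‖ ^ 2 : ℝ) : ℂ) := by
    intro U
    have := Complex.mul_conj' (∑ x, star (v x) * vw d n w U x)
    push_cast
    rw [← this, map_sum, Finset.sum_mul_sum]
    refine Finset.sum_congr rfl fun x _ => Finset.sum_congr rfl fun y _ => ?_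
    simp
    ring
  simp only [h2]
  rw [integral_complex_ofReal]
  exact_mod_cast integral_nonneg fun U => by positivity

lemma vw_mul (d n : ℕ) (w : Fin n → Fin d) (V U : UG d) (x : Fin n → Fin d) :
    vw d n w (V * U) x = ∑ a, tpow d n (V : Matrix (Fin d) (Fin d) ℂ) x a * vw d n w U a := by
  simp only [vw, Submonoid.coe_mul, tpow_mul, Matrix.mul_apply]

lemma rho_inv (d n : ℕ) (w : Fin n → Fin d) (q : Measure (UG d)) [IsProbabilityMeasure q]
    (hinv : ∀ V : UG d, Measure.map (fun U => V * U) q = q) (V : UG d) :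
    tpow d n (V : Matrix (Fin d) (Fin d) ℂ) * rhoWord d n w q *
      (tpow d n (V : Matrix (Fin d) (Fin d) ℂ))ᴴ = rhoWord d n w q := by
  ext x y
  set T := tpow d n (V : Matrix (Fin d) (Fin d) ℂ) with hT
  have h1 : (T * rhoWord d n w q * Tᴴ) x y
      = ∑ a, ∑ b, (T x a * star (T y b)) * rhoWord d n w q a b := by
    simp only [Matrix.mul_apply, Finset.sum_mul, Matrix.conjTranspose_apply]
    rw [Finset.sum_comm]
    refine Finset.sum_congr rfl fun x _ => Finset.sum_congr rfl fun y _ => by ring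
  rw [h1, rho_sum, rho_apply]
  have hm : Measurable fun U : UG d => V * U := (continuous_const.mul continuous_id).measurable
  conv_rhs => rw [← hinv V]
  have hs : AEStronglyMeasurable (fun U : UG d => vw d n w U x * star (vw d n w U y))
      (Measure.map (fun U => V * U) q) :=
    ((vw_cont d n w x).mul (vw_cont d n w y).star).measurable.aestronglyMeasurable
  rw [integral_map hm.aemeasurable hs]
  congr 1
  ext U
  rw [vw_mul, vw_mul, star_sum, Finset.sum_mul_sum]
  refine Finset.sum_congr rfl fun x _ => Finset.sum_congr rfl fun y _ => ?_
  simp [← hT]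
  ring

lemma rho_comm (d n : ℕ) (w : Fin n → Fin d) (q : Measure (UG d)) [IsProbabilityMeasure q]
    (hinv : ∀ V : UG d, Measure.map (fun U => V * U) q = q) (V : UG d) :
    tpow d n (V : Matrix (Fin d) (Fin d) ℂ) * rhoWord d n w q =
      rhoWord d n w q * tpow d n (V : Matrix (Fin d) (Fin d) ℂ) := by
  conv_rhs => rw [← rho_inv d n w q hinv V]
  rw [Matrix.mul_assoc _ _ (tpow d n (V : Matrix (Fin d) (Fin d) ℂ)), tpow_unit, Matrix.mul_one]

lemma exists_phase (d n : ℕ) (z : Fin d) : ∃ V : UG d, ∃ ζ : ℂ, IsPrimitiveRoot ζ (n + 1) ∧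
    (V : Matrix (Fin d) (Fin d) ℂ) = Matrix.diagonal fun i => if i = z then 1 else ζ := by
  have hp := Complex.isPrimitiveRoot_exp (n + 1) (by omega)
  set ζ := Complex.exp (2 * Real.pi * Complex.I / ((n + 1 : ℕ) : ℂ)) with hζ
  have hn : ‖ζ‖ = 1 := hp.norm'_eq_one (by omega)
  refine ⟨⟨Matrix.diagonal fun i => if i = z then 1 else ζ, ?_⟩, ζ, hp, rfl⟩
  rw [Matrix.mem_unitaryGroup_iff, Matrix.star_eq_conjTranspose, Matrix.diagonal_conjTranspose,
    Matrix.diagonal_mul_diagonal, ← Matrix.diagonal_one]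
  congr 1
  ext i
  by_cases h : i = z
  · simp [h]
  · simp [h, Complex.mul_conj', hn]

lemma rho_offdiag (d n : ℕ) (w : Fin n → Fin d) (q : Measure (UG d)) [IsProbabilityMeasure q]
    (hinv : ∀ V : UG d, Measure.map (fun U => V * U) q = q) (z : Fin d) (x : Fin n → Fin d)
    (hx : x ≠ fun _ => z) : rhoWord d n w q x (fun _ => z) = 0 := by
  obtain ⟨V, ζ, hζ, hV⟩ := exists_phase d n z
  have hc := congrFun (congrFun (rho_comm d n w q hinv V) x) (fun _ => z)
  have ht : tpow d n (V : Matrix (Fin d) (Fin d) ℂ)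
      = Matrix.diagonal fun y => ∏ i, if y i = z then 1 else ζ := by
    ext a b
    simp only [tpow, Matrix.of_apply, hV, Matrix.diagonal_apply]
    split_ifs with h
    · subst h; simp
    · obtain ⟨i, hi⟩ := Function.ne_iff.1 h
      exact Finset.prod_eq_zero (Finset.mem_univ i) (by simp [hi])
  rw [ht, Matrix.diagonal_mul, Matrix.mul_diagonal] at hc
  simp only [if_true, Finset.prod_const_one, mul_one, Finset.prod_ite, one_mul,
    Finset.prod_const] at hc
  have hne : ζ ^ (Finset.univ.filter fun i => ¬ x i = z).card ≠ 1 := by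
    apply hζ.pow_ne_one_of_pos_of_lt
    · obtain ⟨i, hi⟩ := Function.ne_iff.1 hx
      exact Finset.card_ne_zero_of_mem (a := i) (by simpa using hi)
    · have := Finset.card_le_univ (Finset.univ.filter fun i => ¬ x i = z)
      simp only [Fintype.card_fin] at this
      omega
  by_contra h0
  exact hne (mul_right_cancel₀ h0 (by rw [hc, one_mul]))

lemma exists_unitary_col (d : ℕ) (z : Fin d) (u : Fin d → ℂ) :
    ∃ (r : ℂ) (V : UG d), ∀ i, u i = r * (V : Matrix (Fin d) (Fin d) ℂ) i z := by
  by_cases hu : u = 0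
  · exact ⟨0, 1, by simp [hu]⟩
  set v : EuclideanSpace ℂ (Fin d) := WithLp.toLp 2 u with hv
  have hv0 : v ≠ 0 := by
    intro h
    apply hu
    funext i
    have := congrArg (fun t : EuclideanSpace ℂ (Fin d) => t i) h
    simpa [hv] using this
  have hnv : (‖v‖ : ℂ) ≠ 0 := by simpa using hv0
  set f : Fin d → EuclideanSpace ℂ (Fin d) := fun _ => (‖v‖⁻¹ : ℂ) • v with hf
  have ho : Orthonormal ℂ (({z} : Set (Fin d)).domRestrict f) := by
    constructor
    · intro i
      change ‖(‖v‖⁻¹ : ℂ) • v‖ = 1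
      simp [norm_smul, hv0]
    · intro i j hij
      exact absurd (Subsingleton.elim i j) hij
  obtain ⟨b, hb⟩ := ho.exists_orthonormalBasis_extension_of_card_eq (by simp)
  refine ⟨‖v‖, ⟨_, (EuclideanSpace.basisFun (Fin d) ℂ).toMatrix_orthonormalBasis_mem_unitary b⟩,
    fun i => ?_⟩
  simp only [Module.Basis.toMatrix_apply, hb z rfl]
  simp only [hf]
  simp
  rw [mul_inv_cancel_left₀ hnv]

lemma rho_tvec (d n : ℕ) (w : Fin n → Fin d) (q : Measure (UG d)) [IsProbabilityMeasure q]
    (hinv : ∀ V : UG d, Measure.map (fun U => V * U) q = q) (z : Fin d) (u : Fin d → ℂ)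
    (x : Fin n → Fin d) :
    ∑ y, rhoWord d n w q x y * tvec d n u y
      = rhoWord d n w q (fun _ => z) (fun _ => z) * tvec d n u x := by
  obtain ⟨r, V, hV⟩ := exists_unitary_col d z u
  have ht : ∀ y, tvec d n u y
      = r ^ n * tpow d n (V : Matrix (Fin d) (Fin d) ℂ) y (fun _ => z) := by
    intro y
    simp [tvec, tpow, hV, Finset.prod_mul_distrib]
  have hc := congrFun (congrFun (rho_comm d n w q hinv V) x) (fun _ => z)
  rw [Matrix.mul_apply, Matrix.mul_apply, Finset.sum_eq_single (fun _ => z)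
    (fun b _ hb => by rw [rho_offdiag d n w q hinv z b hb, mul_zero]) (by simp)] at hc
  simp only [ht, mul_left_comm _ (r ^ n), ← Finset.mul_sum]
  rw [← hc]
  ring

lemma rho_symm (d n : ℕ) (w : Fin n → Fin d) (q : Measure (UG d)) [IsProbabilityMeasure q]
    (hinv : ∀ V : UG d, Measure.map (fun U => V * U) q = q) (z : Fin d) :
    rhoWord d n w q * symmetrizer d n
      = rhoWord d n w q (fun _ => z) (fun _ => z) • symmetrizer d n := by
  ext x y
  rw [Matrix.mul_apply, Matrix.smul_apply, smul_eq_mul]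
  simp only [symm_col, Finset.mul_sum]
  rw [Finset.sum_comm]
  refine Finset.sum_congr rfl fun e _ => ?_
  have := rho_tvec d n w q hinv z (fun k => ∑ i, sgb (e i) * if y i = k then 1 else 0) x
  rw [mul_left_comm, mul_left_comm (rhoWord d n w q (fun _ => z) (fun _ => z)), ← this]
  simp only [Finset.mul_sum]
  refine Finset.sum_congr rfl fun k _ => ?_
  ring

lemma trace_rho (d n : ℕ) (w : Fin n → Fin d) (q : Measure (UG d)) [IsProbabilityMeasure q]
    (M : Matrix (Fin n → Fin d) (Fin n → Fin d) ℂ)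
    (hM : ∀ A, M * tpow d n A = tpow d n A * M) :
    Matrix.trace (M * rhoWord d n w q) = M w w := by
  have h1 : Matrix.trace (M * rhoWord d n w q) = ∑ x, ∑ y, M y x * rhoWord d n w q x y := by
    rw [Matrix.trace]
    simp only [Matrix.diag, Matrix.mul_apply]
    rw [Finset.sum_comm]
  rw [h1, rho_sum]
  have h2 : ∀ U : UG d, ∑ x, ∑ y, M y x * (vw d n w U x * star (vw d n w U y)) = M w w := by
    intro U
    set T := tpow d n (U : Matrix (Fin d) (Fin d) ℂ) with hT
    have h3 : Tᴴ * (M * T) = M := by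
      rw [hM, ← Matrix.mul_assoc, hT, tpow_unit, Matrix.one_mul]
    have h4 := congrFun (congrFun h3 w) w
    rw [← h4, Matrix.mul_apply, Finset.sum_comm]
    refine Finset.sum_congr rfl fun y _ => ?_
    rw [Matrix.mul_apply, Finset.mul_sum]
    refine Finset.sum_congr rfl fun x _ => ?_
    simp only [vw, ← hT, Matrix.conjTranspose_apply]
    ring
  simp only [h2]
  simp

lemma symm_rho_const (d n : ℕ) (z : Fin d) (q : Measure (UG d)) [IsProbabilityMeasure q] :
    symmetrizer d n * rhoWord d n (fun _ => z) q = rhoWord d n (fun _ => z) q := by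
  ext x y
  rw [Matrix.mul_apply]
  refine symm_fix d n (fun t => rhoWord d n (fun _ => z) q t y) (fun p x => ?_) x
  simp only [rho_apply]
  congr 1
  ext U
  congr 1
  exact tvec_perm d n (fun i => (U : Matrix (Fin d) (Fin d) ℂ) i z) p x

open scoped MatrixOrder Matrix.Norms.L2Operator in
lemma trace_mul_psd {ι : Type*} [Fintype ι] [DecidableEq ι] {A B : Matrix ι ι ℂ}
    (hA : A.PosSemidef) (hB : B.PosSemidef) : 0 ≤ (Matrix.trace (A * B)).re := by
  obtain ⟨C, rfl⟩ := CStarAlgebra.nonneg_iff_eq_star_mul_self.mp hA.nonneg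
  rw [Matrix.star_eq_conjTranspose, Matrix.mul_assoc, Matrix.trace_mul_comm]
  have := (hB.mul_mul_conjTranspose_same C).trace_nonneg
  exact (Complex.le_def.1 this).1

/-- For `μ = (n-h, h)` and prior `1/2`, the permutation test maximizes the
average success probability, the optimal value is `1 - 1/(2 binom(n,h))`, the test has perfect
completeness, and soundness `1 - 1/binom(n,h)`. -/
theorem permutation_test_optimal_half (d n h : ℕ) (hd : 2 ≤ d) (hn : 2 ≤ n)
    (hh1 : 1 ≤ h) (hh2 : 2 * h ≤ n)
    (haar : Measure (UG d)) [IsProbabilityMeasure haar]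
    (hinv : ∀ V : UG d, Measure.map (fun U => V * U) haar = haar) :
    (∀ P ∈ POVMs d n,
      successProb d n (by omega) (muTwo d n h hd) (muTwo_sum d n h hd (by omega)) haar (1/2) P ≤
        successProb d n (by omega) (muTwo d n h hd) (muTwo_sum d n h hd (by omega)) haar (1/2)
          (symmetrizer d n)) ∧
    successProb d n (by omega) (muTwo d n h hd) (muTwo_sum d n h hd (by omega)) haar (1/2)
        (symmetrizer d n) = 1 - 1 / (2 * (n.choose h : ℝ)) ∧
    Matrix.trace (symmetrizer d n * rhoEQ d n (by omega) haar) = 1 ∧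
    (1 : ℂ) - Matrix.trace
        (symmetrizer d n * rhoNE d n (muTwo d n h hd) (muTwo_sum d n h hd (by omega)) haar)
      = 1 - ((n.choose h : ℂ))⁻¹ := by
  classical
  set z : Fin d := ⟨0, by omega⟩ with hz
  have hQ0 : rhoEQ d n (by omega) haar = rhoWord d n (fun _ => z) haar := by
    rw [rhoEQ, rhoNE, word_const]
  have hk : symmetrizer d n (word d n (muTwo d n h hd) (muTwo_sum d n h hd (by omega)))
      (word d n (muTwo d n h hd) (muTwo_sum d n h hd (by omega))) = (n.choose h : ℂ)⁻¹ := by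
    rw [symm_diag]
    simp only [word_card]
    have h1 : (∏ i, (muTwo d n h hd i).factorial) = (n - h).factorial * h.factorial := by
      have key : ∀ i : Fin d, (muTwo d n h hd i).factorial
          = (if i = ⟨0, by omega⟩ then (n - h).factorial else 1) *
            (if i = ⟨1, by omega⟩ then h.factorial else 1) := by
        intro i
        by_cases h0 : i = ⟨0, by omega⟩ <;> by_cases h1 : i = ⟨1, by omega⟩ <;>
          simp_all [muTwo, Fin.ext_iff]
      rw [Finset.prod_congr rfl fun i _ => key i, Finset.prod_mul_distrib]
      simp [Finset.prod_ite_eq']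
    rw [h1]
    have h2 := Nat.choose_mul_factorial_mul_factorial (show h ≤ n by omega)
    rw [← h2]
    have h3 : (n.choose h : ℂ) ≠ 0 := by
      exact_mod_cast (Nat.choose_pos (show h ≤ n by omega)).ne'
    have h4 : (h.factorial : ℂ) ≠ 0 := by exact_mod_cast h.factorial_ne_zero
    have h5 : ((n - h).factorial : ℂ) ≠ 0 := by exact_mod_cast (n - h).factorial_ne_zero
    push_cast
    field_simp
  have hR0 : rhoNE d n (muTwo d n h hd) (muTwo_sum d n h hd (by omega)) haar =
    rhoWord d n (word d n (muTwo d n h hd) (muTwo_sum d n h hd (by omega))) haar := rfl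
  simp only [successProb]
  rw [hQ0, hR0]
  generalize word d n (muTwo d n h hd) (muTwo_sum d n h hd (by omega)) = w at hk
  have hR1 : (symmetrizer d n * rhoWord d n w haar).trace = (n.choose h : ℂ)⁻¹ := by
    rw [trace_rho d n w haar _ (symm_comm d n), hk]
  have hRS := rho_symm d n w haar hinv z
  have hQS := rho_symm d n (fun _ => z) haar hinv z
  have hSQ := symm_rho_const d n z haar
  have hQ1' : (rhoWord d n (fun _ => z) haar).trace = 1 := by
    have := trace_rho d n (fun _ => z) haar 1 (by simp)
    rwa [Matrix.one_mul, Matrix.one_apply_eq] at this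
  have hRh := rho_herm d n w haar
  have hQh := rho_herm d n (fun _ => z) haar
  have hRp := rho_psd d n w haar
  have hQp := rho_psd d n (fun _ => z) haar
  have hSh := symm_herm d n
  generalize rhoWord d n w haar = R at *
  generalize rhoWord d n (fun _ => z) haar = Q at *
  generalize symmetrizer d n = S at *
  have hQSQ : Q * S = Q := by
    have := congrArg Matrix.conjTranspose hSQ
    rwa [Matrix.conjTranspose_mul, hSh, hQh] at this
  have hQ1 : (S * Q).trace = 1 := by rw [hSQ, hQ1']
  set c := R (fun _ => z) (fun _ => z)
  set c0 := Q (fun _ => z) (fun _ => z)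
  have hk1 : (1 : ℝ) ≤ (n.choose h : ℝ) := by
    exact_mod_cast Nat.choose_pos (show h ≤ n by omega)
  have hkC : (n.choose h : ℂ)⁻¹ = (((n.choose h : ℝ)⁻¹ : ℝ) : ℂ) := by push_cast; rfl
  rw [hkC] at hR1 ⊢
  have hkinv : (n.choose h : ℝ)⁻¹ ≤ 1 := inv_le_one_of_one_le₀ hk1
  have hval : 1 - 1 / (2 * (n.choose h : ℝ)) = 1 - (n.choose h : ℝ)⁻¹ / 2 := by
    field_simp
  rw [hval]
  generalize (n.choose h : ℝ)⁻¹ = k at *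
  have e1 : c * S.trace = k := by
    rw [← hR1, Matrix.trace_mul_comm, hRS, Matrix.trace_smul, smul_eq_mul]
  have e2 : c0 * S.trace = 1 := by
    rw [← hQ1, Matrix.trace_mul_comm, hQS, Matrix.trace_smul, smul_eq_mul]
  have hS0 : S.trace ≠ 0 := by
    intro h0; rw [h0, mul_zero] at e2; exact zero_ne_one e2
  have e3 : c = k * c0 := by
    apply mul_right_cancel₀ hS0
    rw [e1, mul_assoc, e2, mul_one]
  have hRS' : R * S = (k : ℂ) • Q := by
    rw [hRS, e3, ← hQSQ, hQS, smul_smul]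
  have hSR' : S * R = (k : ℂ) • Q := by
    have := congrArg Matrix.conjTranspose hRS'
    rw [Matrix.conjTranspose_mul, Matrix.conjTranspose_smul, hSh, hRh, hQh] at this
    rw [this]; simp
  have hdiff : (R - (k : ℂ) • Q).PosSemidef := by
    have h1 := hRp.mul_mul_conjTranspose_same (1 - S)
    have h2 : (1 - S) * R * (1 - S)ᴴ = R - (k : ℂ) • Q := by
      rw [Matrix.conjTranspose_sub, hSh, Matrix.conjTranspose_one, Matrix.mul_assoc,
        Matrix.mul_sub, Matrix.mul_one, hRS', Matrix.sub_mul, Matrix.one_mul, Matrix.mul_sub,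
        hSR', Matrix.mul_smul, hSQ, sub_self, sub_zero]
    rwa [h2] at h1
  rw [hQ1, hR1]
  refine ⟨fun P hP => ?_, ?_, rfl, rfl⟩
  · have t1 := trace_mul_psd hP.2 hQp
    have t2 := trace_mul_psd hP.1 hdiff
    rw [Matrix.sub_mul, Matrix.one_mul, Matrix.trace_sub, hQ1', Complex.sub_re] at t1
    rw [Matrix.mul_sub, Matrix.mul_smul, Matrix.trace_sub, Matrix.trace_smul, smul_eq_mul,
      Complex.sub_re, Complex.re_ofReal_mul] at t2
    simp only [Complex.one_re, Complex.ofReal_re] at *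
    nlinarith
  · simp only [Complex.one_re, Complex.ofReal_re]
    ring

end
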